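/- For every integer r ≥ 2, γ(r) ≤ ⌊r/2⌋/r; that is, every r-uniform hypergraph F with exactly three edges satisfies π(F) ≤ ⌊r/2⌋/r. -/

import Mathlib

open Filter

/-- The degree of a vertex in a hypergraph given as a finite set of edges. -/
def hypDegree {V : Type*} [DecidableEq V] (F : Finset (Finset V)) (v : V) : ℕ :=
  (F.filter fun e => v ∈ e).card

/-- `H` contains a copy of `F`: a map injective on the vertex support of `F`
sending every edge of `F` to an edge of `H`. -/
def HasCopy {V W : Type*} [DecidableEq V] (H : Finset (Finset V))
    (F : Finset (Finset W)) : Prop :=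
  ∃ φ : W → V, Set.InjOn φ (⋃ e ∈ F, (e : Set W)) ∧ ∀ e ∈ F, e.image φ ∈ H

/-- `F` is isomorphic to `G` (as edge sets; isolated vertices are irrelevant). -/
def IsIsoTo {V W : Type*} [DecidableEq V] (F : Finset (Finset W))
    (G : Finset (Finset V)) : Prop :=
  ∃ φ : W → V, Set.InjOn φ (⋃ e ∈ F, (e : Set W)) ∧ F.image (fun e => e.image φ) = G

open scoped Classical in
/-- The Turán number `ex(n, F)`: the maximum number of edges of an `F`-free
`r`-uniform hypergraph on `n` vertices. -/
noncomputable def exNum (r n : ℕ) {m : ℕ} (F : Finset (Finset (Fin m))) : ℕ :=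
  ((Finset.univ : Finset (Finset (Finset (Fin n)))).filter fun H =>
    (∀ e ∈ H, e.card = r) ∧ ¬ HasCopy H F).sup Finset.card

/-- The Turán density `π(F) = lim_{n → ∞} ex(n,F) / C(n,r)` (the limit exists). -/
noncomputable def turanDensity (r : ℕ) {m : ℕ} (F : Finset (Finset (Fin m))) : ℝ :=
  limUnder atTop fun n : ℕ => (exNum r n F : ℝ) / (n.choose r : ℝ)

/-- `γ(r)`: the maximum Turán density of an `r`-uniform hypergraph with exactly
three edges. -/
noncomputable def gammaT (r : ℕ) : ℝ :=
  sSup {x : ℝ | ∃ (m : ℕ) (F : Finset (Finset (Fin m))),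
    (∀ e ∈ F, e.card = r) ∧ F.card = 3 ∧ turanDensity r F = x}

/-- The expanded triangle `T_{2k}` on `3k` vertices: three pairwise disjoint
`k`-sets `S 0, S 1, S 2`, with edges `S 0 ∪ S 1`, `S 1 ∪ S 2`, `S 2 ∪ S 0`. -/
def expTriangle (k : ℕ) : Finset (Finset (Fin (3 * k))) :=
  let S : ℕ → Finset (Fin (3 * k)) :=
    fun a => Finset.univ.filter fun v => a * k ≤ v.val ∧ v.val < (a + 1) * k
  {S 0 ∪ S 1, S 1 ∪ S 2, S 2 ∪ S 0}

/-- The suspension of a hypergraph: add the same set of `t` new cone vertices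
to every edge.  For an `s`-graph `F`, the `r`-suspension `F̂^r` is `suspend (r - s) F`. -/
def suspend {m : ℕ} (t : ℕ) (F : Finset (Finset (Fin m))) :
    Finset (Finset (Fin (m + t))) :=
  F.image fun e =>
    e.image (Fin.castAdd t) ∪ Finset.univ.filter fun v : Fin (m + t) => m ≤ v.val

theorem box_lemma (t k : ℕ) : ∀ c : ℝ, 0 < c → ∃ N : ℕ, ∀ n : ℕ, N ≤ n →
    ∀ S : Finset (Fin k → Fin n), c * (n : ℝ) ^ k ≤ S.card →
    ∃ y : Fin k → Fin t → Fin n, (∀ i, Function.Injective (y i)) ∧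
      ∀ s : Fin k → Fin t, (fun i => y i (s i)) ∈ S := by
  induction k with
  | zero =>
    intro c hc
    refine ⟨0, fun n _ S hS => ?_⟩
    have h0 : 0 < S.card := by
      have : (0 : ℝ) < S.card := by
        refine lt_of_lt_of_le ?_ hS
        simpa using hc
      exact_mod_cast this
    obtain ⟨x, hx⟩ := Finset.card_pos.mp h0
    refine ⟨fun i => i.elim0, fun i => i.elim0, fun s => ?_⟩
    convert hx
  | succ k ih =>
    intro c hc
    obtain ⟨N0, hN0⟩ : ∃ N0 : ℕ, (t : ℝ) ≤ N0 * (c / 4) ∧ 0 < N0 := by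
      obtain ⟨N0, h⟩ := exists_nat_ge ((t : ℝ) / (c / 4))
      refine ⟨N0 + 1, ?_, by omega⟩
      rw [div_le_iff₀ (by positivity)] at h
      push_cast
      nlinarith
    obtain ⟨ht, hN0p⟩ := hN0
    set δ : ℝ := (c / 4) / ((N0.choose t : ℝ) + 1) with hδ
    have hδp : 0 < δ := by positivity
    obtain ⟨N1, hN1⟩ := ih δ hδp
    obtain ⟨N2, hN2⟩ := exists_nat_ge ((N0 : ℝ) / (c / 2))
    refine ⟨max N1 (max N2 1), fun n hn S hS => ?_⟩
    have hn1 : N1 ≤ n := le_trans (le_max_left _ _) hn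
    have hn2 : N2 ≤ n := le_trans (le_trans (le_max_left _ _) (le_max_right _ _)) hn
    have hn3 : 1 ≤ n := le_trans (le_trans (le_max_right _ _) (le_max_right _ _)) hn
    have hnp : (0 : ℝ) < n := by exact_mod_cast hn3
    have hnk : (0 : ℝ) < (n : ℝ) ^ k := by positivity
    let Sv : Fin n → Finset (Fin k → Fin n) := fun v =>
      Finset.univ.filter fun x => (Fin.cons v x : Fin (k + 1) → Fin n) ∈ S
    have hsum : (S.card : ℝ) = ∑ v, ((Sv v).card : ℝ) := by
      have : S.card = ∑ v, (Sv v).card := by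
        rw [← Finset.card_sigma]
        symm
        refine Finset.card_bij (fun p _ => Fin.cons p.1 p.2) ?_ ?_ ?_
        · rintro ⟨v, x⟩ h
          simpa [Sv] using h
        · rintro ⟨v, x⟩ h ⟨v', x'⟩ h' heq
          have := Fin.cons_injective2 heq
          obtain ⟨rfl, rfl⟩ := this
          rfl
        · intro z hz
          refine ⟨⟨z 0, Fin.tail z⟩, ?_, ?_⟩
          · simpa [Sv] using hz
          · simp
      rw [this]; push_cast; rfl
    have hcardle : ∀ T : Finset (Fin k → Fin n), (T.card : ℝ) ≤ (n : ℝ) ^ k := by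
      intro T
      have := Finset.card_le_univ T
      simp only [Fintype.card_fun, Fintype.card_fin] at this
      exact_mod_cast this
    let G : Finset (Fin n) := Finset.univ.filter fun v => (c / 2) * (n : ℝ) ^ k ≤ (Sv v).card
    have hG : (N0 : ℝ) ≤ G.card := by
      have h1 : ∑ v, ((Sv v).card : ℝ) ≤ ∑ v, ((if v ∈ G then (n : ℝ) ^ k else 0)
          + (c / 2) * (n : ℝ) ^ k) := by
        refine Finset.sum_le_sum fun v _ => ?_
        by_cases hv : v ∈ G
        · rw [if_pos hv]
          have := hcardle (Sv v)
          have : 0 ≤ (c / 2) * (n : ℝ) ^ k := by positivity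
          linarith [hcardle (Sv v)]
        · rw [if_neg hv]
          simp only [G, Finset.mem_filter, Finset.mem_univ, true_and, not_le] at hv
          linarith
      rw [Finset.sum_add_distrib, Finset.sum_ite_mem] at h1
      simp only [Finset.univ_inter, Finset.sum_const, nsmul_eq_mul, Finset.card_univ,
        Fintype.card_fin] at h1
      rw [← hsum] at h1
      have h2 : (c / 2) * n * (n : ℝ) ^ k ≤ G.card * (n : ℝ) ^ k := by
        rw [pow_succ] at hS
        nlinarith
      have h3 := le_of_mul_le_mul_right h2 hnk
      rw [div_le_iff₀ (by positivity)] at hN2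
      have : (N2 : ℝ) ≤ n := by exact_mod_cast hn2
      nlinarith
    obtain ⟨U, hUG, hU⟩ := Finset.exists_subset_card_eq (s := G) (n := N0) (by exact_mod_cast hG)
    let ST : Finset (Fin n) → Finset (Fin k → Fin n) := fun T =>
      Finset.univ.filter fun x => ∀ v ∈ T, (Fin.cons v x : Fin (k + 1) → Fin n) ∈ S
    -- lower bound on the sum of degrees
    have h1 : (N0 : ℝ) * ((c / 2) * (n : ℝ) ^ k) ≤ ∑ v ∈ U, ((Sv v).card : ℝ) := by
      have := Finset.card_nsmul_le_sum U (fun v => ((Sv v).card : ℝ)) ((c / 2) * (n : ℝ) ^ k)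
        (fun v hv => by
          have := hUG hv
          simpa [G] using this)
      rwa [nsmul_eq_mul, hU] at this
    have h2 : ∑ v ∈ U, (Sv v).card ≤ t * n ^ k + N0 * ∑ T ∈ U.powersetCard t, (ST T).card := by
      have e1 : ∑ v ∈ U, (Sv v).card =
          ∑ x : Fin k → Fin n, (U.filter fun v => (Fin.cons v x : Fin (k + 1) → Fin n) ∈ S).card := by
        simp only [Sv, Finset.card_filter]
        exact Finset.sum_comm
      have e2 : ∑ T ∈ U.powersetCard t, (ST T).card =
          ∑ x : Fin k → Fin n, ((U.powersetCard t).filter fun T =>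
            ∀ v ∈ T, (Fin.cons v x : Fin (k + 1) → Fin n) ∈ S).card := by
        simp only [ST, Finset.card_filter]
        exact Finset.sum_comm
      rw [e1, e2, Finset.mul_sum]
      have e3 : t * n ^ k = ∑ x : Fin k → Fin n, t := by
        simp [mul_comm]
      rw [e3, ← Finset.sum_add_distrib]
      refine Finset.sum_le_sum fun x _ => ?_
      by_cases hx : t ≤ (U.filter fun v => (Fin.cons v x : Fin (k + 1) → Fin n) ∈ S).card
      · obtain ⟨T, hT, hTc⟩ := Finset.exists_subset_card_eq hx
        have h4 : 1 ≤ ((U.powersetCard t).filter fun T =>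
            ∀ v ∈ T, (Fin.cons v x : Fin (k + 1) → Fin n) ∈ S).card := by
          refine Finset.card_pos.mpr ⟨T, ?_⟩
          rw [Finset.mem_filter, Finset.mem_powersetCard]
          refine ⟨⟨fun v hv => (Finset.mem_filter.mp (hT hv)).1, hTc⟩,
            fun v hv => (Finset.mem_filter.mp (hT hv)).2⟩
        have h5 : (U.filter fun v => (Fin.cons v x : Fin (k + 1) → Fin n) ∈ S).card ≤ N0 := by
          rw [← hU]; exact Finset.card_filter_le _ _
        nlinarith
      · omega
    have h3 : (c / 4) * (n : ℝ) ^ k ≤ ∑ T ∈ U.powersetCard t, ((ST T).card : ℝ) := by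
      have h2' : ∑ v ∈ U, ((Sv v).card : ℝ) ≤
          t * (n : ℝ) ^ k + N0 * ∑ T ∈ U.powersetCard t, ((ST T).card : ℝ) := by
        exact_mod_cast h2
      have hN0r : (0 : ℝ) < N0 := by exact_mod_cast hN0p
      have h4 : (t : ℝ) * (n : ℝ) ^ k ≤ N0 * (c / 4) * (n : ℝ) ^ k :=
        mul_le_mul_of_nonneg_right ht hnk.le
      have h5 : (N0 : ℝ) * ((c / 4) * (n : ℝ) ^ k) ≤
          N0 * ∑ T ∈ U.powersetCard t, ((ST T).card : ℝ) := by linarith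
      exact le_of_mul_le_mul_left h5 hN0r
    obtain ⟨T, hT, hTS⟩ : ∃ T ∈ U.powersetCard t, δ * (n : ℝ) ^ k ≤ (ST T).card := by
      by_contra! hcon
      have h4 := Finset.sum_le_card_nsmul (U.powersetCard t) (fun T => ((ST T).card : ℝ))
        (δ * (n : ℝ) ^ k) (fun T hT => (hcon T hT).le)
      rw [Finset.card_powersetCard, hU, nsmul_eq_mul] at h4
      have h5 : δ * ((N0.choose t : ℝ) + 1) = c / 4 := by
        rw [hδ]; field_simp
      have h6 : 0 < δ * (n : ℝ) ^ k := by positivity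
      rw [← h5] at h3
      nlinarith
    obtain ⟨y, hy1, hy2⟩ := hN1 n hn1 (ST T) hTS
    have hTc := (Finset.mem_powersetCard.mp hT).2
    refine ⟨Fin.cons (T.orderEmbOfFin hTc) y, ?_, ?_⟩
    · intro i
      refine Fin.cases ?_ (fun j => ?_) i
      · simpa using (T.orderEmbOfFin hTc).injective
      · simpa using hy1 j
    · intro s
      have h4 := hy2 (fun i => s i.succ)
      simp only [ST, Finset.mem_filter, Finset.mem_univ, true_and] at h4
      have h5 := h4 (T.orderEmbOfFin hTc (s 0)) (Finset.orderEmbOfFin_mem T hTc _)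
      convert h5 using 1
      funext i
      refine Fin.cases ?_ (fun j => ?_) i <;> simp

theorem swap_perm {α : Type*} [DecidableEq α] (B X : Finset α) (hd : Disjoint B X)
    (hc : B.card = X.card) : ∃ σ : Equiv.Perm α, B.image σ = X ∧ X.image σ = B ∧
      ∀ v, v ∉ B → v ∉ X → σ v = v := by
  let e := Finset.equivOfCardEq hc
  let f : α → α := fun v => if h : v ∈ B then (e ⟨v, h⟩ : α) else
    if h : v ∈ X then (e.symm ⟨v, h⟩ : α) else v
  have hB : ∀ v (h : v ∈ B), f v = e ⟨v, h⟩ := fun v h => by simp [f, h]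
  have hX : ∀ v (h : v ∈ X), f v = e.symm ⟨v, h⟩ := fun v h => by
    have : v ∉ B := fun h' => (Finset.disjoint_left.mp hd h') h
    simp [f, h, this]
  have hf : Function.Involutive f := by
    intro v
    by_cases h : v ∈ B
    · rw [hB v h, hX _ (e ⟨v, h⟩).2]; simp
    · by_cases h' : v ∈ X
      · rw [hX v h', hB _ (e.symm ⟨v, h'⟩).2]; simp
      · simp [f, h, h']
  have mB : ∀ v ∈ B, f v ∈ X := fun v h => by rw [hB v h]; exact (e ⟨v, h⟩).2
  have mX : ∀ v ∈ X, f v ∈ B := fun v h => by rw [hX v h]; exact (e.symm ⟨v, h⟩).2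
  refine ⟨hf.toPerm, ?_, ?_, ?_⟩
  · ext v
    simp only [Finset.mem_image, Function.Involutive.coe_toPerm]
    exact ⟨fun ⟨a, ha, h⟩ => h ▸ mB a ha, fun h => ⟨f v, mX v h, hf v⟩⟩
  · ext v
    simp only [Finset.mem_image, Function.Involutive.coe_toPerm]
    exact ⟨fun ⟨a, ha, h⟩ => h ▸ mX a ha, fun h => ⟨f v, mB v h, hf v⟩⟩
  · intro v h h'
    simp [f, h, h']

/-- Cauchy–Schwarz: two edges sharing `R`. -/
theorem cs_count {m n : ℕ} (R B X : Finset (Fin m)) (hRB : Disjoint R B) (hRX : Disjoint R X)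
    (hBX : Disjoint B X) (hc : B.card = X.card) (H : Finset (Finset (Fin n))) :
    ((Finset.univ.filter fun z : Fin m → Fin n => (R ∪ B).image z ∈ H).card : ℝ) ^ 2 ≤
    (n : ℝ) ^ m * ((Finset.univ.filter fun z : Fin m → Fin n =>
      (R ∪ B).image z ∈ H ∧ (R ∪ X).image z ∈ H).card : ℝ) := by
  classical
  obtain ⟨σ, hσB, hσX, hσ⟩ := swap_perm B X hBX hc
  let E := Equiv.piEquivPiSubtypeProd (fun v => v ∈ R) (fun _ : Fin m => Fin n)
  let f : (Fin m → Fin n) → ℝ := fun z => if (R ∪ B).image z ∈ H then 1 else 0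
  let g : (Fin m → Fin n) → ℝ := fun z => if (R ∪ X).image z ∈ H then 1 else 0
  have imcongr : ∀ (S : Finset (Fin m)) (z z' : Fin m → Fin n), (∀ v ∈ S, z v = z' v) →
      S.image z = S.image z' := fun S z z' h => Finset.image_congr h
  have hfc : ∀ z z', (∀ v ∈ R ∪ B, z v = z' v) → f z = f z' := by
    intro z z' h; simp only [f, imcongr _ z z' h]
  have hgc : ∀ z z', (∀ v ∈ R ∪ X, z v = z' v) → g z = g z' := by
    intro z z' h; simp only [g, imcongr _ z z' h]
  have hfg : ∀ z, g z = f (z ∘ σ) := by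
    intro z
    have : (R ∪ B).image (z ∘ σ) = (R ∪ X).image z := by
      rw [← Finset.image_image, Finset.image_union, hσB]
      congr 2
      ext v
      simp only [Finset.mem_image]
      constructor
      · rintro ⟨a, ha, rfl⟩
        rwa [hσ a (Finset.disjoint_left.mp hRB ha) (Finset.disjoint_left.mp hRX ha)]
      · intro h
        exact ⟨v, h, hσ v (Finset.disjoint_left.mp hRB h) (Finset.disjoint_left.mp hRX h)⟩
    simp only [f, g, this]
  let e (u : {v // v ∈ R} → Fin n) (w : {v // v ∉ R} → Fin n) : Fin m → Fin n := E.symm (u, w)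
  have e1 : ∀ u w v (h : v ∈ R), e u w v = u ⟨v, h⟩ := fun u w v h => by
    simp [e, E, Equiv.piEquivPiSubtypeProd, h]
  have e2 : ∀ u w v (h : v ∉ R), e u w v = w ⟨v, h⟩ := fun u w v h => by
    simp [e, E, Equiv.piEquivPiSubtypeProd, h]
  have hsumE : ∀ F : (Fin m → Fin n) → ℝ, ∑ z, F z = ∑ u, ∑ w, F (e u w) := by
    intro F
    rw [← Fintype.sum_prod_type', ← Equiv.sum_comp E.symm]
  -- sums of f and g over the fibre agree
  have hsame : ∀ u, ∑ w, g (e u w) = ∑ w, f (e u w) := by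
    intro u
    have hσR : ∀ v, v ∉ R ↔ σ v ∉ R := by
      have h1 : ∀ v, v ∈ R → σ v = v := fun v h =>
        hσ v (Finset.disjoint_left.mp hRB h) (Finset.disjoint_left.mp hRX h)
      intro v
      rw [not_iff_not]
      constructor
      · intro h; rwa [h1 v h]
      · intro h
        have := h1 _ h
        rwa [σ.injective this] at h
    let τ : Equiv.Perm {v // v ∉ R} := σ.subtypeEquiv hσR
    refine Fintype.sum_equiv (Equiv.arrowCongr τ.symm (Equiv.refl _)) _ _ fun w => ?_
    rw [hfg]
    apply hfc
    intro v _
    by_cases h : v ∈ R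
    · have : σ v = v := hσ v (Finset.disjoint_left.mp hRB h) (Finset.disjoint_left.mp hRX h)
      simp only [Function.comp, this]
      rw [e1 _ _ _ h, e1 _ _ _ h]
    · simp only [Function.comp]
      rw [e2 _ _ _ h, e2 _ _ _ ((hσR v).mp h)]
      simp [Equiv.arrowCongr, τ]
  -- conditional independence
  have hind : ∀ u, (∑ w, f (e u w)) * (∑ w, g (e u w)) =
      (n : ℝ) ^ (Fintype.card {v // v ∉ R}) * ∑ w, f (e u w) * g (e u w) := by
    intro u
    let mix : ({v // v ∉ R} → Fin n) → ({v // v ∉ R} → Fin n) → ({v // v ∉ R} → Fin n) :=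
      fun w w' v => if v.1 ∈ B then w v else w' v
    let M : ({v // v ∉ R} → Fin n) × ({v // v ∉ R} → Fin n) →
      ({v // v ∉ R} → Fin n) × ({v // v ∉ R} → Fin n) := fun p => (mix p.1 p.2, mix p.2 p.1)
    have hM : Function.Involutive M := by
      rintro ⟨w, w'⟩
      simp only [M, mix, Prod.mk.injEq]
      constructor <;> funext v <;> by_cases h : v.1 ∈ B <;> simp [h]
    rw [Finset.sum_mul_sum, ← Fintype.sum_prod_type']
    have h1 : ∑ p : ({v // v ∉ R} → Fin n) × ({v // v ∉ R} → Fin n), f (e u p.1) * g (e u p.2) =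
        ∑ p : ({v // v ∉ R} → Fin n) × ({v // v ∉ R} → Fin n), f (e u p.1) * g (e u p.1) := by
      refine Fintype.sum_equiv hM.toPerm _ _ fun p => ?_
      have h2 : f (e u p.1) = f (e u (mix p.1 p.2)) := by
        apply hfc
        intro v hv
        by_cases h : v ∈ R
        · rw [e1 _ _ _ h, e1 _ _ _ h]
        · rw [e2 _ _ _ h, e2 _ _ _ h]
          have : v ∈ B := by
            rcases Finset.mem_union.mp hv with h' | h'
            · exact absurd h' h
            · exact h'
          simp [mix, this]
      have h3 : g (e u p.2) = g (e u (mix p.1 p.2)) := by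
        apply hgc
        intro v hv
        by_cases h : v ∈ R
        · rw [e1 _ _ _ h, e1 _ _ _ h]
        · rw [e2 _ _ _ h, e2 _ _ _ h]
          have : v ∉ B := by
            rcases Finset.mem_union.mp hv with h' | h'
            · exact absurd h' h
            · exact fun hb => (Finset.disjoint_left.mp hBX hb) h'
          simp [mix, this]
      rw [h2, h3]
      rfl
    rw [h1, Fintype.sum_prod_type]
    simp only [Finset.sum_const, nsmul_eq_mul, Finset.card_univ, Fintype.card_fun,
      Fintype.card_fin, Nat.cast_pow]
    rw [Finset.mul_sum]
  have hP : ((Finset.univ.filter fun z : Fin m → Fin n => (R ∪ B).image z ∈ H).card : ℝ) =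
      ∑ z, f z := by
    simp [f]
  have hQ : ((Finset.univ.filter fun z : Fin m → Fin n =>
      (R ∪ B).image z ∈ H ∧ (R ∪ X).image z ∈ H).card : ℝ) = ∑ z, f z * g z := by
    rw [Finset.card_filter, Nat.cast_sum]
    refine Finset.sum_congr rfl fun z _ => ?_
    by_cases h1 : (R ∪ B).image z ∈ H <;> by_cases h2 : (R ∪ X).image z ∈ H <;> simp [f, g, h1, h2]
  rw [hP, hQ, hsumE, hsumE (fun z => f z * g z)]
  have hcard : Fintype.card {v // v ∈ R} + Fintype.card {v // v ∉ R} = m := by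
    rw [Fintype.card_subtype_compl]
    have := Fintype.card_subtype_le (fun v => v ∈ R)
    rw [Fintype.card_fin] at *
    omega
  calc (∑ u, ∑ w, f (e u w)) ^ 2
      ≤ (Finset.univ : Finset ({v // v ∈ R} → Fin n)).card * ∑ u, (∑ w, f (e u w)) ^ 2 :=
        sq_sum_le_card_mul_sum_sq
    _ = (n : ℝ) ^ (Fintype.card {v // v ∈ R}) * ∑ u, (n : ℝ) ^ (Fintype.card {v // v ∉ R}) *
          ∑ w, f (e u w) * g (e u w) := by
        congr 1
        · simp
        · refine Finset.sum_congr rfl fun u _ => ?_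
          rw [← hind, hsame, sq]
    _ = (n : ℝ) ^ m * ∑ u, ∑ w, f (e u w) * g (e u w) := by
        rw [← Finset.mul_sum, ← mul_assoc, ← pow_add, hcard]

theorem ekr_sub {m r b : ℕ} (E : Finset (Fin m)) (hE : E.card = r) (hr : 0 < r) (hb : 2 * b ≤ r)
    (A : Finset (Finset (Fin m))) (hA : A ⊆ E.powersetCard b)
    (hintr : ∀ B ∈ A, ∀ B' ∈ A, ¬ Disjoint B B') :
    (A.card : ℝ) ≤ (r.choose b : ℝ) * ((b : ℝ) / r) := by
  classical
  let em := E.orderEmbOfFin hE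
  have hem : ∀ v ∈ E, ∃ i, em i = v := by
    intro v hv
    have : v ∈ Set.range em := by rw [Finset.range_orderEmbOfFin]; exact hv
    exact this
  let pb : Finset (Fin m) → Finset (Fin r) := fun B => Finset.univ.filter fun i => em i ∈ B
  have hpb : ∀ B ⊆ E, (pb B).image em = B := by
    intro B hB
    ext v
    simp only [pb, Finset.mem_image, Finset.mem_filter, Finset.mem_univ, true_and]
    constructor
    · rintro ⟨i, hi, rfl⟩; exact hi
    · intro hv
      obtain ⟨i, rfl⟩ := hem v (hB hv)
      exact ⟨i, hv, rfl⟩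
  have hsub : ∀ B ∈ A, B ⊆ E := fun B hB => (Finset.mem_powersetCard.mp (hA hB)).1
  have hcardA : (A.image pb).card = A.card := by
    apply Finset.card_image_of_injOn
    intro B hB B' hB' h
    rw [← hpb B (hsub B hB), ← hpb B' (hsub B' hB')]
    rw [h]
  rcases Nat.eq_zero_or_pos b with rfl | hbp
  · have : A = ∅ := by
      by_contra hne
      obtain ⟨B, hB⟩ := Finset.nonempty_iff_ne_empty.mpr hne
      have h0 : B = ∅ := Finset.card_eq_zero.mp (Finset.mem_powersetCard.mp (hA hB)).2
      exact hintr B hB B hB (by simp [h0])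
    simp [this]
  · have h1 : (A.image pb).card ≤ (r - 1).choose (b - 1) := by
      apply Finset.erdos_ko_rado
      · intro x hx y hy hd
        simp only [Finset.coe_image, Set.mem_image, Finset.mem_coe] at hx hy
        obtain ⟨B, hB, rfl⟩ := hx
        obtain ⟨B', hB', rfl⟩ := hy
        apply hintr B hB B' hB'
        rw [← hpb B (hsub B hB), ← hpb B' (hsub B' hB')]
        exact (Finset.disjoint_image em.injective).mpr hd
      · intro x hx
        simp only [Finset.coe_image, Set.mem_image, Finset.mem_coe] at hx
        obtain ⟨B, hB, rfl⟩ := hx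
        rw [← (Finset.mem_powersetCard.mp (hA hB)).2]
        conv_rhs => rw [← hpb B (hsub B hB)]
        rw [Finset.card_image_of_injective _ em.injective]
      · omega
    rw [hcardA] at h1
    have h2 := Nat.add_one_mul_choose_eq (r - 1) (b - 1)
    rw [Nat.sub_add_cancel hr, Nat.sub_add_cancel hbp] at h2
    have h3 : (r : ℝ) * ((r - 1).choose (b - 1) : ℝ) = (r.choose b : ℝ) * b := by exact_mod_cast h2
    have h4 : (A.card : ℝ) ≤ ((r - 1).choose (b - 1) : ℝ) := by exact_mod_cast h1
    have hrp : (0 : ℝ) < r := by exact_mod_cast hr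
    rw [← mul_div_assoc, le_div_iff₀ hrp]
    nlinarith

/-- any two ordered pairs of disjoint `b`-subsets of `E` are equivalent. -/
theorem pair_perm {m b : ℕ} (E X B1 B2 C1 C2 : Finset (Fin m)) (hEX : Disjoint E X)
    (hB1 : B1 ⊆ E) (hB2 : B2 ⊆ E) (hC1 : C1 ⊆ E) (hC2 : C2 ⊆ E)
    (hB : Disjoint B1 B2) (hC : Disjoint C1 C2) (b1 : B1.card = b) (b2 : B2.card = b)
    (c1 : C1.card = b) (c2 : C2.card = b) :
    ∃ π : Equiv.Perm (Fin m), E.image π = E ∧ ((E \ B1) ∪ X).image π = (E \ C1) ∪ X ∧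
      ((E \ B2) ∪ X).image π = (E \ C2) ∪ X := by
  classical
  let col (B1 B2 : Finset (Fin m)) : Fin m → Fin 5 := fun v =>
    if v ∈ B1 then 0 else if v ∈ B2 then 1 else if v ∈ E then 2 else if v ∈ X then 3 else 4
  have hX : ∀ v, v ∈ X → v ∉ E := fun v h h' => Finset.disjoint_left.mp hEX h' h
  have key : ∀ B1 B2 : Finset (Fin m), B1 ⊆ E → B2 ⊆ E → Disjoint B1 B2 →
      B1.card = b → B2.card = b → ∀ c, (Finset.univ.filter fun v => col B1 B2 v = c).card =
        ![b, b, E.card - b - b, X.card, m - E.card - X.card] c := by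
    intro B1 B2 h1 h2 hd k1 k2 c
    have hd' : ∀ v ∈ B1, v ∉ B2 := fun v h => Finset.disjoint_left.mp hd h
    have s0 : (Finset.univ.filter fun v => col B1 B2 v = 0) = B1 := by
      ext v; simp only [Finset.mem_filter, Finset.mem_univ, true_and, col]; grind
    have s1 : (Finset.univ.filter fun v => col B1 B2 v = 1) = B2 := by
      ext v; simp only [Finset.mem_filter, Finset.mem_univ, true_and, col]; grind
    have s2 : (Finset.univ.filter fun v => col B1 B2 v = 2) = (E \ B1) \ B2 := by
      ext v; simp only [Finset.mem_filter, Finset.mem_univ, true_and, col, Finset.mem_sdiff]; grind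
    have s3 : (Finset.univ.filter fun v => col B1 B2 v = 3) = X := by
      ext v; simp only [Finset.mem_filter, Finset.mem_univ, true_and, col]; grind
    have s4 : (Finset.univ.filter fun v => col B1 B2 v = 4) = (Finset.univ \ E) \ X := by
      ext v; simp only [Finset.mem_filter, Finset.mem_univ, true_and, col, Finset.mem_sdiff]; grind
    fin_cases c
    · simpa [s0] using k1
    · simpa [s1] using k2
    · have : B2 ⊆ E \ B1 := fun v hv => Finset.mem_sdiff.mpr ⟨h2 hv, fun h => hd' v h hv⟩
      change (Finset.univ.filter fun v => col B1 B2 v = 2).card = E.card - b - b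
      rw [s2, Finset.card_sdiff_of_subset this, Finset.card_sdiff_of_subset h1, k1, k2]
    · simp [s3]
    · have : X ⊆ Finset.univ \ E := fun v hv => Finset.mem_sdiff.mpr ⟨Finset.mem_univ _, hX v hv⟩
      change (Finset.univ.filter fun v => col B1 B2 v = 4).card = m - E.card - X.card
      rw [s4, Finset.card_sdiff_of_subset this, Finset.card_sdiff_of_subset (Finset.subset_univ _)]
      simp
  have hfib : ∀ c, Nonempty ({v // col B1 B2 v = c} ≃ {v // col C1 C2 v = c}) := by
    intro c
    rw [← Fintype.card_eq, Fintype.card_subtype, Fintype.card_subtype,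
      key B1 B2 hB1 hB2 hB b1 b2, key C1 C2 hC1 hC2 hC c1 c2]
  let π : Equiv.Perm (Fin m) := Equiv.ofFiberEquiv (fun c => (hfib c).some)
  have hπ : ∀ v, col C1 C2 (π v) = col B1 B2 v := fun v => Equiv.ofFiberEquiv_map _ v
  have him : ∀ S T : Finset (Fin m), (∀ v, v ∈ S ↔ π v ∈ T) → S.image π = T := by
    intro S T h
    ext w
    rw [Finset.mem_image]
    constructor
    · rintro ⟨v, hv, rfl⟩; exact (h v).mp hv
    · intro hw
      refine ⟨π.symm w, (h _).mpr (by simpa using hw), by simp⟩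
  have c0 : ∀ B1 B2 : Finset (Fin m), ∀ v, v ∈ B1 ↔ col B1 B2 v = 0 := by
    intro B1 B2 v; simp only [col]; grind
  have c1' : ∀ B1 B2 : Finset (Fin m), Disjoint B1 B2 → ∀ v, v ∈ B2 ↔ col B1 B2 v = 1 := by
    intro B1 B2 hd v
    have : v ∈ B1 → v ∉ B2 := fun h => Finset.disjoint_left.mp hd h
    simp only [col]; grind
  have c3 : ∀ B1 B2 : Finset (Fin m), B1 ⊆ E → B2 ⊆ E → ∀ v, v ∈ X ↔ col B1 B2 v = 3 := by
    intro B1 B2 h1 h2 v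
    have a1 := @h1 v
    have a2 := @h2 v
    have a3 := hX v
    simp only [col]; grind
  have cE : ∀ B1 B2 : Finset (Fin m), B1 ⊆ E → B2 ⊆ E → ∀ v, v ∈ E ↔ 
      (col B1 B2 v = 0 ∨ col B1 B2 v = 1 ∨ col B1 B2 v = 2) := by
    intro B1 B2 h1 h2 v
    have a1 := @h1 v
    have a2 := @h2 v
    simp only [col]; grind
  have tB1 : ∀ v, v ∈ B1 ↔ π v ∈ C1 := fun v => by rw [c0 B1 B2, c0 C1 C2, hπ]
  have tB2 : ∀ v, v ∈ B2 ↔ π v ∈ C2 := fun v => by rw [c1' B1 B2 hB, c1' C1 C2 hC, hπ]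
  have tX : ∀ v, v ∈ X ↔ π v ∈ X := fun v => by
    rw [c3 B1 B2 hB1 hB2, c3 C1 C2 hC1 hC2, hπ]
  have tE : ∀ v, v ∈ E ↔ π v ∈ E := fun v => by
    rw [cE B1 B2 hB1 hB2, cE C1 C2 hC1 hC2, hπ]
  refine ⟨π, him _ _ tE, him _ _ fun v => ?_, him _ _ fun v => ?_⟩
  · simp only [Finset.mem_union, Finset.mem_sdiff]
    rw [tE v, tB1 v, tX v]
  · simp only [Finset.mem_union, Finset.mem_sdiff]
    rw [tE v, tB2 v, tX v]

theorem edge_count {m n r : ℕ} (E : Finset (Fin m)) (hE : E.card = r)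
    (H : Finset (Finset (Fin n))) (hH : ∀ e ∈ H, e.card = r) :
    H.card * r.factorial * n ^ (m - r) ≤
      (Finset.univ.filter fun z : Fin m → Fin n => E.image z ∈ H).card := by
  classical
  let D := (Σ h : H, ({v // v ∈ E} ≃ {w // w ∈ h.1})) × ({v // v ∉ E} → Fin n)
  have hD : Fintype.card D = H.card * r.factorial * n ^ (m - r) := by
    have h1 : ∀ h : H, Fintype.card ({v // v ∈ E} ≃ {w // w ∈ h.1}) = r.factorial := by
      intro h
      have he : Fintype.card {v // v ∈ E} = Fintype.card {w // w ∈ h.1} := by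
        simp [hE, hH h.1 h.2]
      rw [Fintype.card_equiv (Fintype.equivOfCardEq he)]
      simp [hE]
    simp only [D, Fintype.card_prod, Fintype.card_sigma, h1, Fintype.card_fun, Fintype.card_fin,
      Finset.sum_const, Finset.card_univ, Fintype.card_coe, smul_eq_mul]
    congr 2
    rw [Fintype.card_subtype_compl]
    simp [hE]
  rw [← hD, ← Fintype.card_coe]
  let Φ : D → (Fin m → Fin n) := fun p v => if h : v ∈ E then (p.1.2 ⟨v, h⟩ : Fin n) else p.2 ⟨v, h⟩
  have hΦ : ∀ p : D, E.image (Φ p) = p.1.1.1 := by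
    intro p
    ext w
    rw [Finset.mem_image]
    constructor
    · rintro ⟨v, hv, rfl⟩
      simp only [Φ, hv, dif_pos]
      exact (p.1.2 ⟨v, hv⟩).2
    · intro hw
      refine ⟨(p.1.2.symm ⟨w, hw⟩ : Fin m), (p.1.2.symm ⟨w, hw⟩).2, ?_⟩
      simp [Φ]
  refine Fintype.card_le_of_injective (fun p => ⟨Φ p, ?_⟩) ?_
  · simp only [Finset.mem_filter, Finset.mem_univ, true_and, hΦ]
    exact p.1.1.2
  · intro p q hpq
    have hpq' : Φ p = Φ q := congrArg Subtype.val hpq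
    have h1 : p.1.1 = q.1.1 := by
      apply Subtype.ext
      rw [← hΦ p, ← hΦ q, hpq']
    obtain ⟨⟨h, f⟩, g⟩ := p
    obtain ⟨⟨h', f'⟩, g'⟩ := q
    simp only at h1
    subst h1
    have hf : f = f' := by
      ext v
      have := congrFun hpq' v.1
      simp only [Φ, v.2, dif_pos] at this
      exact congrArg Fin.val this
    have hg : g = g' := by
      funext v
      have := congrFun hpq' v.1
      simp only [Φ, v.2, dif_neg, not_false_eq_true] at this
      exact this
    rw [hf, hg]

theorem good_count {m n r b : ℕ} (E X B1 B2 : Finset (Fin m)) (hE : E.card = r) (hr : 0 < r)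
    (hX : X.card = b) (hEX : Disjoint E X) (hB1 : B1 ⊆ E) (hB2 : B2 ⊆ E) (hB : Disjoint B1 B2)
    (b1 : B1.card = b) (b2 : B2.card = b) (hn : 0 < n)
    (H : Finset (Finset (Fin n))) (ε : ℝ) (hε : 0 < ε)
    (hP : ((b : ℝ) / r + ε) * (n : ℝ) ^ m ≤
      ((Finset.univ.filter fun z : Fin m → Fin n => E.image z ∈ H).card : ℝ)) :
    ε ^ 2 / ((r.choose b : ℝ) ^ 2) * (n : ℝ) ^ m ≤
      ((Finset.univ.filter fun z : Fin m → Fin n => E.image z ∈ H ∧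
        ((E \ B1) ∪ X).image z ∈ H ∧ ((E \ B2) ∪ X).image z ∈ H).card : ℝ) := by
  classical
  have h2b : 2 * b ≤ r := by
    have := Finset.card_le_card (Finset.union_subset hB1 hB2)
    rw [Finset.card_union_of_disjoint hB, b1, b2, hE] at this
    omega
  have hM : (0 : ℝ) < r.choose b := by
    exact_mod_cast Nat.choose_pos (by omega)
  have hrp : (0 : ℝ) < r := by exact_mod_cast hr
  have hnm : (0 : ℝ) < (n : ℝ) ^ m := by positivity
  let P : Finset (Fin m → Fin n) := Finset.univ.filter fun z => E.image z ∈ H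
  let fam : (Fin m → Fin n) → Finset (Finset (Fin m)) := fun z =>
    (E.powersetCard b).filter fun B => ((E \ B) ∪ X).image z ∈ H
  let G : Finset (Fin m → Fin n) := P.filter fun z =>
    ∃ B ∈ fam z, ∃ B' ∈ fam z, Disjoint B B'
  let S : Finset (Fin m) → Finset (Fin m) → Finset (Fin m → Fin n) := fun C1 C2 =>
    Finset.univ.filter fun z => E.image z ∈ H ∧ ((E \ C1) ∪ X).image z ∈ H ∧
      ((E \ C2) ∪ X).image z ∈ H
  have hfamcard : ∀ z, ((fam z).card : ℝ) ≤ r.choose b := by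
    intro z
    have : (fam z).card ≤ (E.powersetCard b).card := Finset.card_filter_le _ _
    rw [Finset.card_powersetCard, hE] at this
    exact_mod_cast this
  -- lower bound for the sum
  have hlow : (r.choose b : ℝ) * (P.card : ℝ) ^ 2 ≤ (n : ℝ) ^ m * ∑ z ∈ P, ((fam z).card : ℝ) := by
    have h1 : ∑ z ∈ P, ((fam z).card : ℝ) = ∑ B ∈ E.powersetCard b,
        ((Finset.univ.filter fun z : Fin m → Fin n => E.image z ∈ H ∧
          ((E \ B) ∪ X).image z ∈ H).card : ℝ) := by
      have : ∑ z ∈ P, (fam z).card = ∑ B ∈ E.powersetCard b,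
        (Finset.univ.filter fun z : Fin m → Fin n => E.image z ∈ H ∧
          ((E \ B) ∪ X).image z ∈ H).card := by
        simp only [← Finset.filter_filter]
        simp only [fam, Finset.card_filter]
        exact Finset.sum_comm
      exact_mod_cast this
    rw [h1, Finset.mul_sum]
    have h2 := Finset.card_nsmul_le_sum (E.powersetCard b) (fun B => (n : ℝ) ^ m *
      ((Finset.univ.filter fun z : Fin m → Fin n => E.image z ∈ H ∧
          ((E \ B) ∪ X).image z ∈ H).card : ℝ)) ((P.card : ℝ) ^ 2) ?_
    · rwa [nsmul_eq_mul, Finset.card_powersetCard, hE] at h2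
    · intro B hBm
      obtain ⟨hBE, hBc⟩ := Finset.mem_powersetCard.mp hBm
      have := cs_count (n := n) (E \ B) B X Finset.sdiff_disjoint
        (Finset.disjoint_of_subset_left Finset.sdiff_subset hEX)
        (Finset.disjoint_of_subset_left hBE hEX) (by rw [hBc, hX]) H
      rwa [Finset.sdiff_union_of_subset hBE] at this
  have hup : ∑ z ∈ P, ((fam z).card : ℝ) ≤
      (r.choose b : ℝ) * ((b : ℝ) / r) * P.card + (r.choose b : ℝ) * G.card := by
    have h1 : ∑ z ∈ P, ((fam z).card : ℝ) ≤ ∑ z ∈ P, ((r.choose b : ℝ) * ((b : ℝ) / r) +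
        if (∃ B ∈ fam z, ∃ B' ∈ fam z, Disjoint B B') then (r.choose b : ℝ) else 0) := by
      refine Finset.sum_le_sum fun z _ => ?_
      have h0 : 0 ≤ (r.choose b : ℝ) * ((b : ℝ) / r) := by positivity
      split_ifs with h
      · linarith [hfamcard z]
      · push Not at h
        rw [add_zero]
        exact ekr_sub E hE hr h2b (fam z) (Finset.filter_subset _ _) h
    refine h1.trans (le_of_eq ?_)
    rw [Finset.sum_add_distrib, Finset.sum_const, nsmul_eq_mul, ← Finset.sum_filter,
      Finset.sum_const, nsmul_eq_mul]
    simp only [G]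
    ring
  have hG : ε ^ 2 * (n : ℝ) ^ m ≤ G.card := by
    have h1 : (r.choose b : ℝ) * (P.card : ℝ) ^ 2 ≤ (r.choose b : ℝ) * ((n : ℝ) ^ m *
      ((b : ℝ) / r * P.card + G.card)) := by
      refine hlow.trans ?_
      have := mul_le_mul_of_nonneg_left hup hnm.le
      linarith
    have h2 := le_of_mul_le_mul_left h1 hM
    have hP' : ((b : ℝ) / r + ε) * (n : ℝ) ^ m ≤ P.card := hP
    set β : ℝ := (b : ℝ) / r with hβ
    have hβ0 : 0 ≤ β := by positivity
    have h3 : ε * (n : ℝ) ^ m * (ε * (n : ℝ) ^ m) ≤ P.card * (P.card - β * (n : ℝ) ^ m) := by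
      apply mul_le_mul
      · nlinarith
      · nlinarith
      · positivity
      · positivity
    have h4 : (n : ℝ) ^ m * (ε ^ 2 * (n : ℝ) ^ m) ≤ (n : ℝ) ^ m * G.card := by nlinarith
    exact le_of_mul_le_mul_left h4 hnm
  -- all the `S C1 C2` have the same size
  have hS : ∀ C1 ∈ E.powersetCard b, ∀ C2 ∈ E.powersetCard b, Disjoint C1 C2 →
      (S C1 C2).card ≤ (S B1 B2).card := by
    intro C1 hC1 C2 hC2 hC
    obtain ⟨hC1E, c1⟩ := Finset.mem_powersetCard.mp hC1
    obtain ⟨hC2E, c2⟩ := Finset.mem_powersetCard.mp hC2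
    obtain ⟨π, p1, p2, p3⟩ := pair_perm E X B1 B2 C1 C2 hEX hB1 hB2 hC1E hC2E hB hC b1 b2 c1 c2
    refine Finset.card_le_card_of_injOn (fun z => z ∘ π) ?_ ?_
    · intro z hz
      simp only [S, Finset.coe_filter, Finset.mem_univ, true_and, Set.mem_ofPred_eq] at hz ⊢
      rw [← Finset.image_image, ← Finset.image_image, ← Finset.image_image, p1, p2, p3]
      exact hz
    · intro z _ z' _ h
      exact (Equiv.surjective π).injective_comp_right h
  have hGS : G.card ≤ (r.choose b) ^ 2 * (S B1 B2).card := by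
    let I := ((E.powersetCard b) ×ˢ (E.powersetCard b)).filter fun p => Disjoint p.1 p.2
    have h1 : G ⊆ I.biUnion fun p => S p.1 p.2 := by
      intro z hz
      simp only [G, P, fam, Finset.mem_filter, Finset.mem_univ, true_and] at hz
      obtain ⟨hz, B, ⟨hB, hB'⟩, C, ⟨hC, hC'⟩, hd⟩ := hz
      rw [Finset.mem_biUnion]
      refine ⟨(B, C), ?_, ?_⟩
      · simp only [I, Finset.mem_filter, Finset.mem_product]
        exact ⟨⟨hB, hC⟩, hd⟩
      · simp only [S, Finset.mem_filter, Finset.mem_univ, true_and]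
        exact ⟨hz, hB', hC'⟩
    refine (Finset.card_le_card h1).trans ?_
    refine (Finset.card_biUnion_le_card_mul I _ (S B1 B2).card ?_).trans ?_
    · intro p hp
      simp only [I, Finset.mem_filter, Finset.mem_product] at hp
      exact hS _ hp.1.1 _ hp.1.2 hp.2
    · refine Nat.mul_le_mul_right _ ?_
      refine (Finset.card_filter_le _ _).trans ?_
      rw [Finset.card_product, Finset.card_powersetCard, hE, sq]
  have hGS' : (G.card : ℝ) ≤ (r.choose b : ℝ) ^ 2 * (S B1 B2).card := by exact_mod_cast hGS
  rw [div_mul_eq_mul_div, div_le_iff₀ (by positivity)]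
  calc ε ^ 2 * (n : ℝ) ^ m ≤ G.card := hG
    _ ≤ _ := hGS'
    _ = _ := by rw [mul_comm]

theorem exists_min_map {m : ℕ} (F : Finset (Finset (Fin m))) :
    ∃ ψ : Fin m → Fin m, (∀ e ∈ F, Set.InjOn ψ (e : Set (Fin m))) ∧
      ∀ e ∈ F, ∀ e' ∈ F, ∀ x ∈ e, ∀ y ∈ e', ψ x ≠ ψ y →
        ∃ e'' ∈ F, ψ x ∈ e''.image ψ ∧ ψ y ∈ e''.image ψ := by
  classical
  let Q : Finset (Fin m → Fin m) :=
    Finset.univ.filter fun ψ => ∀ e ∈ F, Set.InjOn ψ (e : Set (Fin m))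
  have hQ : Q.Nonempty := ⟨id, by simp [Q, Function.injective_id.injOn]⟩
  obtain ⟨ψ, hψ, hmin⟩ := Finset.exists_min_image Q (fun ψ => (Finset.univ.image ψ).card) hQ
  have hψ' : ∀ e ∈ F, Set.InjOn ψ (e : Set (Fin m)) := by simpa [Q] using hψ
  refine ⟨ψ, hψ', ?_⟩
  intro e he e' he' x hx y hy hxy
  by_contra! hcon
  let μ : Fin m → Fin m := fun v => if v = ψ x then ψ y else v
  have hmem : (μ ∘ ψ) ∈ Q := by
    simp only [Q, Finset.mem_filter, Finset.mem_univ, true_and]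
    intro f hf u hu v hv huv
    have hc := hcon f hf
    have hu' : ψ u ∈ f.image ψ := Finset.mem_image_of_mem _ hu
    have hv' : ψ v ∈ f.image ψ := Finset.mem_image_of_mem _ hv
    apply hψ' f hf hu hv
    simp only [Function.comp, μ] at huv
    split_ifs at huv with h1 h2 h2
    · rw [h1, h2]
    · exact absurd (huv ▸ hv') (hc (h1 ▸ hu'))
    · exact absurd (huv ▸ hu') (hc (h2 ▸ hv'))
    · exact huv
  have h1 := hmin _ hmem
  have h2 : (Finset.univ.image (μ ∘ ψ)) ⊂ Finset.univ.image ψ := by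
    rw [Finset.ssubset_iff_of_subset]
    · refine ⟨ψ x, by simp, ?_⟩
      simp only [Finset.mem_image, Finset.mem_univ, true_and, Function.comp, μ, not_exists]
      intro v h
      split_ifs at h with h3
      · exact hxy h.symm
      · exact h3 h
    · intro w hw
      simp only [Finset.mem_image, Finset.mem_univ, true_and, Function.comp, μ] at hw ⊢
      obtain ⟨v, rfl⟩ := hw
      split_ifs
      · exact ⟨y, rfl⟩
      · exact ⟨v, rfl⟩
  exact absurd h1 (not_le.mpr (Finset.card_lt_card h2))

/-- No private vertices in a pair-covering triple of `r`-sets. -/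
theorem no_private {α : Type*} [DecidableEq α] {r : ℕ} (E1 E2 E3 : Finset α)
    (h1 : E1.card = r) (h2 : E2.card = r) 
    (hcov : ∀ x ∈ E1, ∀ y ∈ E2, x ≠ y →
      (x ∈ E1 ∧ y ∈ E1) ∨ (x ∈ E2 ∧ y ∈ E2) ∨ (x ∈ E3 ∧ y ∈ E3)) :
    ∀ x ∈ E1, x ∈ E2 ∨ x ∈ E3 := by
  intro x hx
  by_contra! hcon
  have hsub : E2 ⊆ E1 := by
    intro y hy
    by_contra hy1
    have hne : x ≠ y := fun h => hcon.1 (h ▸ hy)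
    rcases hcov x hx y hy hne with h | h | h
    · exact hy1 h.2
    · exact hcon.1 h.1
    · exact hcon.2 h.1
  have := Finset.eq_of_subset_of_card_le hsub (by omega)
  exact hcon.1 (this ▸ hx)

theorem copy_of_box {m n : ℕ} (F : Finset (Finset (Fin m))) (H : Finset (Finset (Fin n)))
    (ψ : Fin m → Fin m) (hψ : ∀ e ∈ F, Set.InjOn ψ (e : Set (Fin m)))
    (S : Finset (Fin m → Fin n)) (hS : ∀ z ∈ S, ∀ e ∈ F, (e.image ψ).image z ∈ H)
    (hinj : ∀ z ∈ S, ∀ e ∈ F, ∀ e' ∈ F, ∀ x ∈ e, ∀ y ∈ e', z (ψ x) = z (ψ y) → ψ x = ψ y)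
    (y : Fin m → Fin m → Fin n) (hy : ∀ i, Function.Injective (y i))
    (hyS : ∀ s : Fin m → Fin m, (fun i => y i (s i)) ∈ S) : HasCopy H F := by
  classical
  refine ⟨fun w => y (ψ w) w, ?_, ?_⟩
  · intro w hw w' hw' h
    simp only [Set.mem_iUnion, Finset.mem_coe, exists_prop] at hw hw'
    obtain ⟨e, he, hwe⟩ := hw
    obtain ⟨e', he', hwe'⟩ := hw'
    simp only at h
    by_cases hp : ψ w = ψ w'
    · rw [hp] at h
      exact hy _ h
    · exfalso
      let s : Fin m → Fin m := fun i => if i = ψ w then w else w'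
      apply hp
      apply hinj _ (hyS s) e he e' he' w hwe w' hwe'
      simp only [s, if_pos, if_neg (Ne.symm hp)]
      exact h
  · intro e he
    let s : Fin m → Fin m := fun i => if h : ∃ w ∈ e, ψ w = i then h.choose else i
    have hs : ∀ w ∈ e, s (ψ w) = w := by
      intro w hw
      have hex : ∃ w' ∈ e, ψ w' = ψ w := ⟨w, hw, rfl⟩
      simp only [s, dif_pos hex]
      exact hψ e he hex.choose_spec.1 hw hex.choose_spec.2
    have := hS _ (hyS s) e he
    rw [Finset.image_image] at this
    convert this using 1
    apply Finset.image_congr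
    intro w hw
    simp only [Function.comp, hs w hw]

theorem exNum_step (r n : ℕ) {m : ℕ} (F : Finset (Finset (Fin m))) :
    exNum r (n + 1) F * (n + 1 - r) ≤ (n + 1) * exNum r n F := by
  classical
  -- pick an extremal graph
  have hle : ∀ H : Finset (Finset (Fin (n + 1))), (∀ e ∈ H, e.card = r) → ¬ HasCopy H F →
      H.card * (n + 1 - r) ≤ (n + 1) * exNum r n F := by
    intro H hH hF
    let Hv : Fin (n + 1) → Finset (Finset (Fin n)) := fun v =>
      Finset.univ.filter fun e => e.image v.succAbove ∈ H
    have hHv : ∀ v, (Hv v).card ≤ exNum r n F := by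
      intro v
      unfold exNum
      refine Finset.le_sup (f := Finset.card) ?_
      simp only [Finset.mem_filter, Finset.mem_univ, true_and]
      constructor
      · intro e he
        simp only [Hv, Finset.mem_filter, Finset.mem_univ, true_and] at he
        rw [← hH _ he, Finset.card_image_of_injective _ Fin.succAbove_right_injective]
      · rintro ⟨φ, hφ, hc⟩
        apply hF
        refine ⟨v.succAbove ∘ φ, Fin.succAbove_right_injective.comp_injOn hφ, ?_⟩
        intro e he
        have := hc e he
        simp only [Hv, Finset.mem_filter, Finset.mem_univ, true_and] at this
        rwa [Finset.image_image] at this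
    have hcount : ∀ v, (H.filter fun e => v ∉ e).card ≤ (Hv v).card := by
      intro v
      have : H.filter (fun e => v ∉ e) ⊆ (Hv v).image (fun e => e.image v.succAbove) := by
        intro e he
        rw [Finset.mem_filter] at he
        have h1 : (Finset.univ.filter fun i => v.succAbove i ∈ e).image v.succAbove = e := by
          ext w
          simp only [Finset.mem_image, Finset.mem_filter, Finset.mem_univ, true_and]
          constructor
          · rintro ⟨i, hi, rfl⟩; exact hi
          · intro hw
            obtain ⟨i, rfl⟩ := Fin.exists_succAbove_eq (x := w) (y := v) (fun h => he.2 (h ▸ hw))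
            exact ⟨i, hw, rfl⟩
        rw [Finset.mem_image]
        refine ⟨_, ?_, h1⟩
        simp only [Hv, Finset.mem_filter, Finset.mem_univ, true_and]
        rw [h1]; exact he.1
      exact (Finset.card_le_card this).trans Finset.card_image_le
    have hdc : ∑ v : Fin (n + 1), (H.filter fun e => v ∉ e).card = H.card * (n + 1 - r) := by
      simp only [Finset.card_filter]
      rw [Finset.sum_comm]
      rw [← smul_eq_mul, ← Finset.sum_const]
      refine Finset.sum_congr rfl fun e he => ?_
      rw [← Finset.card_filter]
      have : (Finset.univ.filter fun v => v ∉ e) = eᶜ := by ext; simp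
      rw [this, Finset.card_compl, hH e he, Fintype.card_fin]
    rw [← hdc]
    calc _ ≤ ∑ v : Fin (n + 1), exNum r n F :=
          Finset.sum_le_sum fun v _ => (hcount v).trans (hHv v)
      _ = _ := by simp
  have hsup : ∀ q, exNum r (n + 1) F = q → q * (n + 1 - r) ≤ (n + 1) * exNum r n F := by
    intro q hq
    rcases Nat.eq_zero_or_pos q with rfl | hqp
    · simp
    · unfold exNum at hq
      rcases Finset.eq_empty_or_nonempty ((Finset.univ :
          Finset (Finset (Finset (Fin (n + 1))))).filter fun H =>
          (∀ e ∈ H, e.card = r) ∧ ¬ HasCopy H F) with he | hne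
      · rw [he] at hq
        simp at hq
        omega
      · obtain ⟨H, hH, hHq⟩ := Finset.exists_mem_eq_sup _ hne Finset.card
        rw [hHq] at hq
        rw [Finset.mem_filter] at hH
        rw [← hq]
        exact hle H hH.2.1 hH.2.2
  exact hsup _ rfl

theorem exNum_tendsto (r : ℕ) {m : ℕ} (F : Finset (Finset (Fin m))) :
    ∃ l : ℝ, Tendsto (fun n : ℕ => (exNum r n F : ℝ) / (n.choose r : ℝ)) atTop (nhds l) := by
  have hanti : Antitone fun n : ℕ => (exNum r (n + r) F : ℝ) / ((n + r).choose r : ℝ) := by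
    apply antitone_nat_of_succ_le
    intro n
    have h1 := exNum_step r (n + r) F
    have h2 := Nat.choose_mul_succ_eq (n + r) r
    have e : n + 1 + r = n + r + 1 := by ring
    rw [e]
    have e' : n + r + 1 - r = n + 1 := by omega
    rw [e'] at h1 h2
    have hp1 : (0 : ℝ) < ((n + r).choose r : ℝ) := by
      exact_mod_cast Nat.choose_pos (by omega)
    have hp2 : (0 : ℝ) < ((n + r + 1).choose r : ℝ) := by
      exact_mod_cast Nat.choose_pos (by omega)
    rw [div_le_div_iff₀ hp2 hp1]
    have h1' : (exNum r (n + r + 1) F : ℝ) * (n + 1) ≤ (n + r + 1) * exNum r (n + r) F := by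
      exact_mod_cast h1
    have h2' : ((n + r).choose r : ℝ) * (n + r + 1) = ((n + r + 1).choose r : ℝ) * (n + 1) := by
      exact_mod_cast h2
    have hn : (0 : ℝ) < (n : ℝ) + 1 := by positivity
    refine le_of_mul_le_mul_right ?_ hn
    calc (exNum r (n + r + 1) F : ℝ) * ((n + r).choose r : ℝ) * (n + 1)
        = (exNum r (n + r + 1) F : ℝ) * (n + 1) * ((n + r).choose r : ℝ) := by ring
      _ ≤ (n + r + 1) * exNum r (n + r) F * ((n + r).choose r : ℝ) :=
          mul_le_mul_of_nonneg_right h1' hp1.le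
      _ = exNum r (n + r) F * (((n + r).choose r : ℝ) * (n + r + 1)) := by ring
      _ = _ := by rw [h2']; ring
  refine ⟨_, (tendsto_add_atTop_iff_nat r).mp (tendsto_atTop_ciInf hanti ?_)⟩
  refine ⟨0, ?_⟩
  rintro x ⟨n, rfl⟩
  positivity

theorem choose_asymp (r : ℕ) (β ε : ℝ) (hβ : 0 ≤ β) (hε : 0 < ε) :
    ∃ N : ℕ, ∀ n, N ≤ n →
      (β + ε / 2) * (n : ℝ) ^ r ≤ (β + ε) * (n.choose r : ℝ) * (r.factorial : ℝ) := by
  have h := isEquivalent_choose r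
  have h2 : ∀ᶠ n : ℕ in atTop, (n ^ r / r.factorial : ℝ) ≠ 0 := by
    filter_upwards [eventually_gt_atTop 0] with n hn
    have : (0 : ℝ) < n := by exact_mod_cast hn
    positivity
  rw [Asymptotics.isEquivalent_iff_tendsto_one h2] at h
  have hlt : (β + ε / 2) / (β + ε) < 1 := by
    rw [div_lt_one (by positivity)]; linarith
  have h3 := (h.eventually (lt_mem_nhds hlt)).and (eventually_gt_atTop 0)
  obtain ⟨N, hN⟩ := eventually_atTop.mp h3
  refine ⟨N, fun n hn => ?_⟩
  obtain ⟨h4, h5⟩ := hN n hn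
  have hn' : (0 : ℝ) < n := by exact_mod_cast h5
  simp only [Pi.div_apply] at h4
  rw [div_lt_div_iff₀ (by positivity) (by positivity)] at h4
  have h6 : (0 : ℝ) < r.factorial := by positivity
  have h7 : (β + ε / 2) * ((n : ℝ) ^ r / r.factorial) * r.factorial ≤
      (n.choose r : ℝ) * (β + ε) * r.factorial := mul_le_mul_of_nonneg_right h4.le h6.le
  have h8 : (β + ε / 2) * ((n : ℝ) ^ r / r.factorial) * r.factorial = (β + ε / 2) * (n : ℝ) ^ r := by
    field_simp
  linarith

theorem main_bound {r m : ℕ} (hr : 2 ≤ r) (F : Finset (Finset (Fin m)))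
    (hF : ∀ e ∈ F, e.card = r) (hF3 : F.card = 3) (ε : ℝ) (hε : 0 < ε) :
    ∃ N : ℕ, ∀ n, N ≤ n → ∀ H : Finset (Finset (Fin n)), (∀ e ∈ H, e.card = r) →
      ¬ HasCopy H F → (H.card : ℝ) ≤ (((r / 2 : ℕ) : ℝ) / r + ε) * (n.choose r : ℝ) := by
  classical
  obtain ⟨ψ, hψ, hcov⟩ := exists_min_map F
  obtain ⟨e1, e2, e3, -, -, -, rfl⟩ := Finset.card_eq_three.mp hF3
  have m1 : e1 ∈ ({e1, e2, e3} : Finset (Finset (Fin m))) := by simp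
  have m2 : e2 ∈ ({e1, e2, e3} : Finset (Finset (Fin m))) := by simp
  have m3 : e3 ∈ ({e1, e2, e3} : Finset (Finset (Fin m))) := by simp
  have hcardi : ∀ e ∈ ({e1, e2, e3} : Finset (Finset (Fin m))), (e.image ψ).card = r :=
    fun e he => by rw [Finset.card_image_of_injOn (hψ e he), hF e he]
  have hcov' : ∀ e ∈ ({e1, e2, e3} : Finset (Finset (Fin m))),
      ∀ e' ∈ ({e1, e2, e3} : Finset (Finset (Fin m))), ∀ x ∈ e.image ψ, ∀ y ∈ e'.image ψ, x ≠ y →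
      (x ∈ e1.image ψ ∧ y ∈ e1.image ψ) ∨ (x ∈ e2.image ψ ∧ y ∈ e2.image ψ) ∨
        (x ∈ e3.image ψ ∧ y ∈ e3.image ψ) := by
    intro e he e' he' x hx y hy hne
    obtain ⟨x, hx0, rfl⟩ := Finset.mem_image.mp hx
    obtain ⟨y, hy0, rfl⟩ := Finset.mem_image.mp hy
    obtain ⟨e'', h, hh⟩ := hcov e he e' he' x hx0 y hy0 hne
    simp only [Finset.mem_insert, Finset.mem_singleton] at h
    rcases h with rfl | rfl | rfl
    · exact Or.inl hh
    · exact Or.inr (Or.inl hh)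
    · exact Or.inr (Or.inr hh)
  have k1 := hcardi e1 m1
  have k2 := hcardi e2 m2
  have k3 := hcardi e3 m3
  have v12 := hcov' e1 m1 e2 m2
  have v21 := hcov' e2 m2 e1 m1
  have v31 := hcov' e3 m3 e1 m1
  set E1 := e1.image ψ with hE1
  set E2 := e2.image ψ with hE2
  set E3 := e3.image ψ with hE3
  have p1 : ∀ x ∈ E1, x ∈ E2 ∨ x ∈ E3 := no_private E1 E2 E3 k1 k2 v12
  have p2 : ∀ x ∈ E2, x ∈ E1 ∨ x ∈ E3 := no_private E2 E1 E3 k2 k1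
    (fun x hx y hy h => by have := v21 x hx y hy h; tauto)
  have p3 : ∀ x ∈ E3, x ∈ E1 ∨ x ∈ E2 := no_private E3 E1 E2 k3 k1
    (fun x hx y hy h => by have := v31 x hx y hy h; tauto)
  let X := E2 \ E1
  let B1 := E1 \ E2
  let B2 := E1 \ E3
  let b := X.card
  have hX3 : E3 \ E1 = X := by
    ext x; simp only [X, Finset.mem_sdiff]
    have := p2 x; have := p3 x; tauto
  have q2 : (E1 \ B1) ∪ X = E2 := by
    ext x; simp only [X, B1, Finset.mem_sdiff, Finset.mem_union]; tauto
  have q3 : (E1 \ B2) ∪ X = E3 := by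
    rw [← hX3]
    ext x; simp only [B2, Finset.mem_sdiff, Finset.mem_union]; tauto
  have b1 : B1.card = b := Finset.card_sdiff_comm (by rw [k1, k2])
  have b2 : B2.card = b := by
    simp only [b, ← hX3]
    exact Finset.card_sdiff_comm (by rw [k1, k3])
  have hB : Disjoint B1 B2 := by
    rw [Finset.disjoint_left]
    intro x hx hx'
    simp only [B1, B2, Finset.mem_sdiff] at hx hx'
    have := p1 x; tauto
  have hEX : Disjoint E1 X := Finset.disjoint_sdiff
  have hB1 : B1 ⊆ E1 := Finset.sdiff_subset
  have hB2 : B2 ⊆ E1 := Finset.sdiff_subset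
  have h2b : b ≤ r / 2 := by
    have := Finset.card_le_card (Finset.union_subset hB1 hB2)
    rw [Finset.card_union_of_disjoint hB, b1, b2, k1] at this
    omega
  have hrm : r ≤ m := by
    have := Finset.card_le_univ E1
    rwa [k1, Fintype.card_fin] at this
  have hrp : (0 : ℝ) < r := by exact_mod_cast (by omega : 0 < r)
  set β : ℝ := ((r / 2 : ℕ) : ℝ) / r with hβ
  have hβ0 : 0 ≤ β := by positivity
  have hbβ : (b : ℝ) / r ≤ β := by
    rw [hβ]; gcongr
  have hch : (0 : ℝ) < r.choose b := by exact_mod_cast Nat.choose_pos (by omega)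
  obtain ⟨N1, hN1⟩ := box_lemma m m ((ε / 2) ^ 2 / ((r.choose b : ℝ) ^ 2)) (by positivity)
  obtain ⟨N2, hN2⟩ := choose_asymp r β ε hβ0 hε
  refine ⟨max 1 (max N1 N2), fun n hn H hH hfree => ?_⟩
  have n1 : 0 < n := lt_of_lt_of_le one_pos ((le_max_left _ _).trans hn)
  have n2 : N1 ≤ n := (le_max_left _ _).trans ((le_max_right _ _).trans hn)
  have n3 : N2 ≤ n := (le_max_right _ _).trans ((le_max_right _ _).trans hn)
  by_contra! hlt
  apply hfree
  have hP : ((b : ℝ) / r + ε / 2) * (n : ℝ) ^ m ≤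
      ((Finset.univ.filter fun z : Fin m → Fin n => E1.image z ∈ H).card : ℝ) := by
    have h1 : ((H.card * r.factorial * n ^ (m - r) : ℕ) : ℝ) ≤
      ((Finset.univ.filter fun z : Fin m → Fin n => E1.image z ∈ H).card : ℝ) := by
      exact_mod_cast edge_count E1 k1 H hH
    refine le_trans ?_ h1
    have h2 := hN2 n n3
    have h3 : (n : ℝ) ^ m = (n : ℝ) ^ r * (n : ℝ) ^ (m - r) := by
      rw [← pow_add]; congr 1; omega
    push_cast
    rw [h3, ← mul_assoc]
    refine mul_le_mul_of_nonneg_right ?_ (by positivity)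
    calc ((b : ℝ) / r + ε / 2) * (n : ℝ) ^ r ≤ (β + ε / 2) * (n : ℝ) ^ r := by gcongr
      _ ≤ _ := h2
      _ ≤ _ := by gcongr
  have hgood := good_count E1 X B1 B2 k1 (by omega) rfl hEX hB1 hB2 hB b1 b2 n1 H (ε / 2)
    (by positivity) hP
  rw [q2, q3] at hgood
  obtain ⟨y, hy, hyS⟩ := hN1 n n2 _ hgood
  have hSm : ∀ z : Fin m → Fin n, z ∈ (Finset.univ.filter fun z : Fin m → Fin n =>
      E1.image z ∈ H ∧ E2.image z ∈ H ∧ E3.image z ∈ H) →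
      ∀ e ∈ ({e1, e2, e3} : Finset (Finset (Fin m))), (e.image ψ).image z ∈ H := by
    intro z hz e he
    simp only [Finset.mem_filter, Finset.mem_univ, true_and] at hz
    simp only [Finset.mem_insert, Finset.mem_singleton] at he
    rcases he with rfl | rfl | rfl
    · exact hz.1
    · exact hz.2.1
    · exact hz.2.2
  refine copy_of_box _ H ψ hψ _ hSm ?_ y hy hyS
  intro z hz e he e' he' x hx y hy hxy
  by_contra hne
  obtain ⟨f, hf, hxf, hyf⟩ := hcov e he e' he' x hx y hy hne
  have hmem := hSm z hz f hf
  have hc : ((f.image ψ).image z).card = (f.image ψ).card := by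
    rw [hH _ hmem, hcardi f hf]
  exact hne (Finset.card_image_iff.mp hc hxf hyf hxy)

theorem density_bound {r m : ℕ} (hr : 2 ≤ r) (F : Finset (Finset (Fin m)))
    (hF : ∀ e ∈ F, e.card = r) (hF3 : F.card = 3) :
    turanDensity r F ≤ ((r / 2 : ℕ) : ℝ) / (r : ℝ) := by
  classical
  obtain ⟨l, hl⟩ := exNum_tendsto r F
  have h1 : turanDensity r F = l := hl.limUnder_eq
  rw [h1]
  refine le_of_forall_pos_le_add fun ε hε => ?_
  obtain ⟨N, hN⟩ := main_bound hr F hF hF3 ε hε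
  refine le_of_tendsto hl ?_
  filter_upwards [eventually_ge_atTop N, eventually_ge_atTop r] with n hn hnr
  have hp : (0 : ℝ) < (n.choose r : ℝ) := by exact_mod_cast Nat.choose_pos hnr
  rw [div_le_iff₀ hp]
  unfold exNum
  rcases Finset.eq_empty_or_nonempty ((Finset.univ :
      Finset (Finset (Finset (Fin n)))).filter fun H =>
      (∀ e ∈ H, e.card = r) ∧ ¬ HasCopy H F) with he | hne
  · rw [he]
    simp only [Finset.sup_empty, Nat.bot_eq_zero, Nat.cast_zero]
    positivity
  · obtain ⟨H, hH, hHq⟩ := Finset.exists_mem_eq_sup _ hne Finset.card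
    rw [hHq]
    rw [Finset.mem_filter] at hH
    exact hN n hn H hH.2.1 hH.2.2


/-- For every `r ≥ 2`, `γ(r) ≤ ⌊r/2⌋ / r`; that is, every `r`-graph with
exactly three edges has Turán density at most `⌊r/2⌋ / r`. -/
theorem gammaT_le_half_floor (r : ℕ) (hr : 2 ≤ r) :
    gammaT r ≤ ((r / 2 : ℕ) : ℝ) / (r : ℝ) ∧
    ∀ (m : ℕ) (F : Finset (Finset (Fin m))),
      (∀ e ∈ F, e.card = r) → F.card = 3 →
      turanDensity r F ≤ ((r / 2 : ℕ) : ℝ) / (r : ℝ) := by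
  refine ⟨?_, fun m F hF hF3 => density_bound hr F hF hF3⟩
  refine Real.sSup_le ?_ (by positivity)
  rintro x ⟨m, F, hF, hF3, rfl⟩
  exact density_bound hr F hF hF3
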